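/- arXiv:2305.18415 — 2 statements merged into one kernel-verified Lean document; each statement's English description precedes it below -/
import Mathlib

section
/- Let r ∈ {0,1}. Every linear Pin(n,0,r)-equivariant map φ: G_{n,0,r} → G_{n,0,r} decomposes as a finite sum φ = Σ_{l,k,m} φ_{lkm} of linear Pin(n,0,r)-equivariant maps, where each φ_{lkm} vanishes on all grades other than k and maps k-blades to l-blades. Moreover, if r = 0, or if r = 1 and k < n+1, each such map φ_{lkm} is uniquely determined by its value on any single non-ideal k-blade (e.g. e_1e_2⋯e_k); if r = 1 and k = n+1, it is uniquely determined by its value on a pseudoscalar (e.g. e_0e_1⋯e_n). -/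
open CliffordAlgebra

noncomputable section

/-- The quadratic form of the geometric algebra `G_{n,0,r}`: the first `n` coordinates are
orthogonal basis vectors `e_1, …, e_n` of square `+1`, while the remaining `r` coordinates
are degenerate directions of square `0` (when `r = 1`, the last coordinate is `e_0`). -/
def gaForm (n r : ℕ) : QuadraticForm ℝ (Fin (n + r) → ℝ) :=
  QuadraticMap.weightedSumSquares ℝ (fun i : Fin (n + r) => if (i : ℕ) < n then (1 : ℝ) else 0)

/-- The geometric algebra `G_{n,0,r}`, as a real Clifford algebra. -/
abbrev GA (n r : ℕ) := CliffordAlgebra (gaForm n r)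

/-- The `i`-th basis vector of the underlying quadratic space. -/
def gaBasisVec (n r : ℕ) (i : Fin (n + r)) : Fin (n + r) → ℝ := Pi.single i 1

/-- The `i`-th basis vector, embedded in the geometric algebra. -/
def eVec (n r : ℕ) (i : Fin (n + r)) : GA n r := ι (gaForm n r) (gaBasisVec n r i)

instance : Invertible (2 : ℝ) := invertibleOfNonzero two_ne_zero

/-- The canonical linear equivalence with the exterior algebra (used to transport the
grading and the wedge product to the Clifford algebra). -/
def gaToExt (n r : ℕ) : GA n r ≃ₗ[ℝ] ExteriorAlgebra ℝ (Fin (n + r) → ℝ) :=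
  CliffordAlgebra.equivExterior (gaForm n r)

/-- Grade-`k` projection `⟨x⟩_k` of a multivector, setting all non-grade-`k`
components to zero. -/
def gradeProj (n r : ℕ) (k : ℕ) : GA n r →ₗ[ℝ] GA n r :=
  (gaToExt n r).symm.toLinearMap ∘ₗ
    (GradedAlgebra.proj (fun i : ℕ => ⋀[ℝ]^i (Fin (n + r) → ℝ)) k) ∘ₗ
      (gaToExt n r).toLinearMap

/-- Wedge (exterior) product of multivectors. -/
def wedge (n r : ℕ) (x y : GA n r) : GA n r :=
  (gaToExt n r).symm (gaToExt n r x * gaToExt n r y)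

/-- The versor (geometric product of vectors) associated to a list of vectors. -/
def versor (n r : ℕ) (l : List (Fin (n + r) → ℝ)) : GA n r :=
  (l.map (ι (gaForm n r))).prod

/-- `IsUnitVecList n r l` : every vector in the list `l` is an (invertible) unit vector,
so that `versor n r l` is an element of the Pin group. -/
def IsUnitVecList (n r : ℕ) (l : List (Fin (n + r) → ℝ)) : Prop :=
  ∀ v ∈ l, gaForm n r v = 1

/-- The sandwich action `u[x]` of the Pin-group element `u = v_1 ⋯ v_k` (presented by the
list `l = [v_1, …, v_k]` of unit vectors) on a multivector `x`: `u[x] = u x̂ u⁻¹` if `u` is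
odd and `u[x] = u x u⁻¹` if `u` is even, where `x̂` is the grade involution and where
`u⁻¹ = ũ` (the reversal) for a product of unit vectors. -/
def pinAction (n r : ℕ) (l : List (Fin (n + r) → ℝ)) (x : GA n r) : GA n r :=
  versor n r l * ((⇑(involute (Q := gaForm n r)))^[l.length] x) * reverse (versor n r l)

/-- The blade (wedge product) determined by a list of vectors. -/
def bladeList (n r : ℕ) (vs : List (Fin (n + r) → ℝ)) : GA n r :=
  vs.foldr (fun v acc => wedge n r (ι (gaForm n r) v) acc) 1

/-- `IsBlade n r k x` : `x` is a `k`-blade, i.e. a (scaled) wedge product of `k` vectors. -/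
def IsBlade (n r : ℕ) (k : ℕ) (x : GA n r) : Prop :=
  ∃ (c : ℝ) (vs : List (Fin (n + r) → ℝ)), vs.length = k ∧ x = c • bladeList n r vs

/-- Scalar (grade-0) coefficient of a multivector. -/
def scalarCoeff (n r : ℕ) (x : GA n r) : ℝ :=
  ExteriorAlgebra.algebraMapInv (gaToExt n r x)

/-- Squared norm `‖x‖² = ⟨x x̃⟩₀` of a multivector. -/
def gaNormSq (n r : ℕ) (x : GA n r) : ℝ :=
  scalarCoeff n r (x * reverse x)

/-- Norm `‖x‖ = √⟨x x̃⟩₀` of a multivector. -/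
def gaNorm (n r : ℕ) (x : GA n r) : ℝ := Real.sqrt (gaNormSq n r x)

/-- Left contraction `v ⌋ x` of a multivector `x` by a vector `v`, defined gradewise by
`v ⌋ ⟨x⟩_l = ⟨ v ⟨x⟩_l ⟩_{l-1}`. -/
def vContr (n r : ℕ) (v : Fin (n + r) → ℝ) (x : GA n r) : GA n r :=
  ∑ l ∈ Finset.range (n + r + 1),
    gradeProj n r (l - 1) (ι (gaForm n r) v * gradeProj n r l x)

/-- A blade (or multivector) is ideal if it is the wedge of a nonzero null vector
(a multiple of `e_0`) with some multivector. -/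
def IsIdealMV (n r : ℕ) (x : GA n r) : Prop :=
  ∃ (v : Fin (n + r) → ℝ) (y : GA n r),
    v ≠ 0 ∧ gaForm n r v = 0 ∧ x = wedge n r (ι (gaForm n r) v) y

/-- `Pin(n,0,r)`-equivariance of a linear map, for the sandwich action. -/
def IsPinEquivariant (n r : ℕ) (ψ : GA n r →ₗ[ℝ] GA n r) : Prop :=
  ∀ l : List (Fin (n + r) → ℝ), IsUnitVecList n r l →
    ∀ x : GA n r, ψ (pinAction n r l x) = pinAction n r l (ψ x)

section AbstractClassification

variable {V : Type*} [AddCommGroup V] [Module ℝ V] {n : ℕ}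

/-- wedge monomials -/
def mono (u : Fin n → V) (L : List (Fin n)) : ExteriorAlgebra ℝ V :=
  (L.map (fun i => ExteriorAlgebra.ι ℝ (u i))).prod

/-- the linear map commutes with the functorial action of `g` -/
def Comm (φ : ExteriorAlgebra ℝ V →ₗ[ℝ] ExteriorAlgebra ℝ V) (g : V →ₗ[ℝ] V) : Prop :=
  ∀ x, φ (ExteriorAlgebra.map g x) = ExteriorAlgebra.map g (φ x)

theorem Comm.comp {φ : ExteriorAlgebra ℝ V →ₗ[ℝ] ExteriorAlgebra ℝ V} {g h : V →ₗ[ℝ] V}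
    (hg : Comm φ g) (hh : Comm φ h) : Comm φ (g ∘ₗ h) := by
  intro x
  rw [← ExteriorAlgebra.map_comp_map]
  simp only [AlgHom.comp_apply]
  rw [hg, hh]

theorem mono_nil (u : Fin n → V) : mono u [] = 1 := by simp [mono]

theorem mono_cons (u : Fin n → V) (i : Fin n) (L : List (Fin n)) :
    mono u (i :: L) = ExteriorAlgebra.ι ℝ (u i) * mono u L := by simp [mono]

theorem map_mono_congr (u u' : Fin n → V) (g : V →ₗ[ℝ] V) (L : List (Fin n))
    (h : ∀ i ∈ L, g (u i) = u' i) : ExteriorAlgebra.map g (mono u L) = mono u' L := by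
  induction L with
  | nil => simp [mono]
  | cons i L ih =>
    rw [mono_cons, mono_cons, map_mul, ih (fun j hj => h j (List.mem_cons_of_mem _ hj)),
      ExteriorAlgebra.map_apply_ι, h i List.mem_cons_self]

theorem mono_map (u : Fin n → V) (σ : Fin n → Fin n) (L : List (Fin n)) :
    mono u (L.map σ) = mono (fun i => u (σ i)) L := by
  simp [mono, Function.comp_def]

theorem ι_anti (x y : V) (w : ExteriorAlgebra ℝ V) :
    ExteriorAlgebra.ι ℝ x * (ExteriorAlgebra.ι ℝ y * w)
      = -(ExteriorAlgebra.ι ℝ y * (ExteriorAlgebra.ι ℝ x * w)) := by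
  rw [← mul_assoc, ← mul_assoc, ← neg_mul]
  congr 1
  exact eq_neg_of_add_eq_zero_left (ExteriorAlgebra.ι_add_mul_swap x y)

theorem ι_sq_mul (x : V) (w : ExteriorAlgebra ℝ V) :
    ExteriorAlgebra.ι ℝ x * (ExteriorAlgebra.ι ℝ x * w) = 0 := by
  rw [← mul_assoc, ExteriorAlgebra.ι_sq_zero, zero_mul]

theorem mono_mul_of_mem (u : Fin n → V) (i : Fin n) (L : List (Fin n)) (h : i ∈ L) :
    ExteriorAlgebra.ι ℝ (u i) * mono u L = 0 := by
  induction L with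
  | nil => simp at h
  | cons j L ih =>
    rw [mono_cons]
    rcases List.mem_cons.1 h with rfl | h
    · exact ι_sq_mul _ _
    · rw [ι_anti, ih h, mul_zero, neg_zero]

theorem mono_perm (u : Fin n → V) {L M : List (Fin n)} (h : L.Perm M) :
    ∃ c : ℝ, mono u L = c • mono u M := by
  induction h with
  | nil => exact ⟨1, by simp⟩
  | cons x _ ih =>
    obtain ⟨c, hc⟩ := ih
    exact ⟨c, by rw [mono_cons, mono_cons, hc, mul_smul_comm]⟩
  | swap x y l => exact ⟨-1, by simp only [mono_cons]; rw [ι_anti]; simp⟩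
  | trans _ _ ih1 ih2 =>
    obtain ⟨c, hc⟩ := ih1
    obtain ⟨d, hd⟩ := ih2
    exact ⟨c * d, by rw [hc, hd, smul_smul]⟩

/-- The spanning set of monomials whose index sets agree with `L` on `s`. -/
def monoSet (u : Fin n → V) (z : V) (L : List (Fin n)) (s : Finset (Fin n)) :
    Set (ExteriorAlgebra ℝ V) :=
  {y | ∃ M : List (Fin n), M.Nodup ∧ (∀ i ∈ s, (i ∈ M ↔ i ∈ L)) ∧
    (y = mono u M ∨ y = ExteriorAlgebra.ι ℝ z * mono u M)}

theorem span_monoSet (u : Fin n → V) (z : V)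
    (hspan : ∀ w : V, ∃ (c : Fin n → ℝ) (d : ℝ), w = ∑ i, c i • u i + d • z) (L : List (Fin n)) :
    ∀ x, x ∈ Submodule.span ℝ (monoSet u z L ∅) := by
  intro x
  induction x using CliffordAlgebra.left_induction with
  | algebraMap r =>
    rw [Algebra.algebraMap_eq_smul_one]
    exact Submodule.smul_mem _ _ (Submodule.subset_span
      ⟨[], List.nodup_nil, by simp, Or.inl (mono_nil u).symm⟩)
  | add x y hx hy => exact Submodule.add_mem _ hx hy
  | ι_mul x m hx =>
    change ExteriorAlgebra.ι ℝ m * x ∈ _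
    have key : ∀ (v : V), ((∃ i, v = u i) ∨ v = z) →
        ExteriorAlgebra.ι ℝ v * x ∈ Submodule.span ℝ (monoSet u z L ∅) := by
      intro v hv
      induction hx using Submodule.span_induction with
      | zero => simp
      | add x y _ _ h1 h2 => rw [mul_add]; exact Submodule.add_mem _ h1 h2
      | smul a x _ h => rw [mul_smul_comm]; exact Submodule.smul_mem _ _ h
      | mem x hx =>
        obtain ⟨M, hM, -, hx⟩ := hx
        have hu : ∀ i, ExteriorAlgebra.ι ℝ (u i) * mono u M = 0 ∨ (i :: M).Nodup := by
          intro i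
          by_cases hi : i ∈ M
          · exact Or.inl (mono_mul_of_mem u i M hi)
          · exact Or.inr (List.nodup_cons.2 ⟨hi, hM⟩)
        rcases hv with ⟨i, rfl⟩ | rfl <;> rcases hx with rfl | rfl
        · rcases hu i with h | h
          · rw [h]; exact Submodule.zero_mem _
          · exact Submodule.subset_span ⟨_, h, by simp, Or.inl (mono_cons _ _ _).symm⟩
        · rw [ι_anti]
          refine Submodule.neg_mem _ ?_
          rcases hu i with h | h
          · rw [h, mul_zero]; exact Submodule.zero_mem _
          · exact Submodule.subset_span ⟨_, h, by simp, Or.inr (by rw [mono_cons])⟩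
        · exact Submodule.subset_span ⟨_, hM, by simp, Or.inr rfl⟩
        · rw [ι_sq_mul]; exact Submodule.zero_mem _
    obtain ⟨c, d, rfl⟩ := hspan m
    simp only [map_add, map_sum, map_smul, add_mul, Finset.sum_mul, smul_mul_assoc]
    exact Submodule.add_mem _ (Submodule.sum_mem _ fun i _ =>
      Submodule.smul_mem _ _ (key _ (Or.inl ⟨i, rfl⟩))) (Submodule.smul_mem _ _ (key _ (Or.inr rfl)))

theorem map_flip_mono (u : Fin n → V) (i : Fin n) (g : V →ₗ[ℝ] V)
    (hi : g (u i) = -u i) (hj : ∀ j, j ≠ i → g (u j) = u j) (L : List (Fin n)) (hL : L.Nodup) :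
    ExteriorAlgebra.map g (mono u L) = (if i ∈ L then (-1 : ℝ) else 1) • mono u L := by
  induction L with
  | nil => simp [mono]
  | cons j L ih =>
    obtain ⟨hjL, hL⟩ := List.nodup_cons.1 hL
    rw [mono_cons, map_mul, ih hL, ExteriorAlgebra.map_apply_ι]
    by_cases h : j = i
    · subst h
      simp [hi, hjL]
    · rw [hj j h]
      have : i ≠ j := fun e => h e.symm
      simp [this]

/-- Common eigenvectors of all the sign flips are combinations of two monomials. -/
theorem eigen_mem (u : Fin n → V) (z : V)
    (hspan : ∀ w : V, ∃ (c : Fin n → ℝ) (d : ℝ), w = ∑ i, c i • u i + d • z)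
    (g : Fin n → V →ₗ[ℝ] V) (hgi : ∀ i, g i (u i) = -u i)
    (hgj : ∀ i j, j ≠ i → g i (u j) = u j) (hgz : ∀ i, g i z = z)
    (L : List (Fin n)) (hL : L.Nodup) (y : ExteriorAlgebra ℝ V)
    (hy : ∀ i, ExteriorAlgebra.map (g i) y = (if i ∈ L then (-1 : ℝ) else 1) • y) :
    ∃ a b : ℝ, y = a • mono u L + b • (ExteriorAlgebra.ι ℝ z * mono u L) := by
  have h1 : ∀ s : Finset (Fin n), y ∈ Submodule.span ℝ (monoSet u z L s) := by
    intro s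
    induction s using Finset.induction_on with
    | empty => exact span_monoSet u z hspan L y
    | insert i s his ih =>
      set ε : ℝ := if i ∈ L then (-1 : ℝ) else 1 with hε
      have hεε : ε * ε = 1 := by rw [hε]; split_ifs <;> norm_num
      let A : ExteriorAlgebra ℝ V →ₗ[ℝ] ExteriorAlgebra ℝ V :=
        (1/2 : ℝ) • (LinearMap.id + ε • (ExteriorAlgebra.map (g i)).toLinearMap)
      have hA : ∀ x, A x = (1/2 : ℝ) • (x + ε • ExteriorAlgebra.map (g i) x) := fun x => rfl
      have hAy : A y = y := by
        rw [hA, hy i, smul_smul, hεε, one_smul, ← two_smul ℝ y, smul_smul]; norm_num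
      rw [← hAy]
      have : Submodule.span ℝ (monoSet u z L s) ≤
          (Submodule.span ℝ (monoSet u z L (insert i s))).comap A := by
        rw [Submodule.span_le]
        rintro x ⟨M, hM, hMs, hx⟩
        have hx' : ExteriorAlgebra.map (g i) x = (if i ∈ M then (-1 : ℝ) else 1) • x := by
          rcases hx with rfl | rfl
          · exact map_flip_mono u i (g i) (hgi i) (hgj i) M hM
          · rw [map_mul, map_flip_mono u i (g i) (hgi i) (hgj i) M hM,
              ExteriorAlgebra.map_apply_ι, hgz, mul_smul_comm]
        change A x ∈ Submodule.span ℝ (monoSet u z L (insert i s))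
        rw [hA, hx', smul_smul]
        by_cases hiM : (i ∈ M ↔ i ∈ L)
        · refine Submodule.smul_mem _ _ (Submodule.add_mem _ ?_ (Submodule.smul_mem _ _ ?_)) <;>
          · refine Submodule.subset_span ⟨M, hM, ?_, hx⟩
            intro j hj
            rcases Finset.mem_insert.1 hj with rfl | hj
            · exact hiM
            · exact hMs j hj
        · have : ε * (if i ∈ M then (-1 : ℝ) else 1) = -1 := by
            rw [hε]; by_cases h1 : i ∈ M <;> by_cases h2 : i ∈ L <;> simp_all
          rw [this]; simp
      exact this ih
  have h2 : Submodule.span ℝ (monoSet u z L Finset.univ) ≤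
      Submodule.span ℝ {mono u L, ExteriorAlgebra.ι ℝ z * mono u L} := by
    rw [Submodule.span_le]
    rintro x ⟨M, hM, hMs, hx⟩
    have hp : M.Perm L := (List.perm_ext_iff_of_nodup hM hL).2 fun i => hMs i (Finset.mem_univ i)
    obtain ⟨c, hc⟩ := mono_perm u hp
    rcases hx with rfl | rfl
    · rw [hc]
      exact Submodule.smul_mem _ _ (Submodule.subset_span (by simp))
    · rw [hc, mul_smul_comm]
      exact Submodule.smul_mem _ _ (Submodule.subset_span (by simp))
  obtain ⟨a, b, h⟩ := Submodule.mem_span_pair.1 (h2 (h1 Finset.univ))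
  exact ⟨a, b, h.symm⟩

theorem exists_perm_map {L M : List (Fin n)} (hL : L.Nodup) (hM : M.Nodup)
    (h : L.length = M.length) : ∃ σ : Equiv.Perm (Fin n), L.map σ = M := by
  classical
  let e : {x // x ∈ L} ≃ {x // x ∈ M} :=
    (hL.getEquiv L).symm.trans ((finCongr h).trans (hM.getEquiv M))
  refine ⟨e.extendSubtype, ?_⟩
  apply List.ext_getElem
  · simpa using h
  · intro i h1 h2
    have hi : i < L.length := by simpa using h1
    rw [List.getElem_map, Equiv.extendSubtype_apply_of_mem _ _ (List.getElem_mem hi)]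
    have : (⟨L[i], List.getElem_mem hi⟩ : {x // x ∈ L}) = hL.getEquiv L ⟨i, hi⟩ := rfl
    rw [this]
    simp [e]

theorem uniform_coeff (u : Fin n → V) (z : V)
    (hspan : ∀ w : V, ∃ (c : Fin n → ℝ) (d : ℝ), w = ∑ i, c i • u i + d • z)
    (φ : ExteriorAlgebra ℝ V →ₗ[ℝ] ExteriorAlgebra ℝ V)
    (g : Fin n → V →ₗ[ℝ] V) (hg : ∀ i, Comm φ (g i)) (hgi : ∀ i, g i (u i) = -u i)
    (hgj : ∀ i j, j ≠ i → g i (u j) = u j) (hgz : ∀ i, g i z = z)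
    (hσ : ∀ σ : Equiv.Perm (Fin n), ∃ s : V →ₗ[ℝ] V, Comm φ s ∧ (∀ i, s (u i) = u (σ i)) ∧ s z = z)
    (w : ExteriorAlgebra ℝ V)
    (hw : ∀ s : V →ₗ[ℝ] V, s z = z → ExteriorAlgebra.map s w = w) (k : ℕ) :
    ∃ a b : ℝ, ∀ L : List (Fin n), L.Nodup → L.length = k →
      φ (w * mono u L) = a • mono u L + b • (ExteriorAlgebra.ι ℝ z * mono u L) := by
  by_cases hex : ∃ L : List (Fin n), L.Nodup ∧ L.length = k
  · obtain ⟨L, hL, hk⟩ := hex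
    obtain ⟨a, b, hab⟩ := eigen_mem u z hspan g hgi hgj hgz L hL (φ (w * mono u L)) (by
      intro i
      rw [← hg i, map_mul, hw _ (hgz i), map_flip_mono u i (g i) (hgi i) (hgj i) L hL,
        mul_smul_comm, map_smul])
    refine ⟨a, b, fun M hM hMk => ?_⟩
    obtain ⟨σ, rfl⟩ := exists_perm_map hL hM (hk.trans hMk.symm)
    obtain ⟨s, hs, hsu, hsz⟩ := hσ σ
    have hm : ExteriorAlgebra.map s (mono u L) = mono u (L.map σ) := by
      rw [mono_map]; exact map_mono_congr _ _ _ _ fun i _ => hsu i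
    have := hs (w * mono u L)
    rw [map_mul, hw s hsz, hm, hab] at this
    rw [this]
    simp only [map_add, map_smul, map_mul, hm, ExteriorAlgebra.map_apply_ι, hsz]
  · push Not at hex
    exact ⟨0, 0, fun L hL hk => absurd hk (hex L hL)⟩

theorem mono_mem (u : Fin n → V) (L : List (Fin n)) : mono u L ∈ ⋀[ℝ]^(L.length) V := by
  induction L with
  | nil => rw [mono_nil]; exact SetLike.GradedOne.one_mem (A := fun i : ℕ => ⋀[ℝ]^i V)
  | cons i L ih =>
    rw [mono_cons, List.length_cons, add_comm]
    refine SetLike.GradedMul.mul_mem (A := fun i : ℕ => ⋀[ℝ]^i V) ?_ ih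
    simp

theorem ι_mul_mem (z : V) {k : ℕ} {x : ExteriorAlgebra ℝ V} (hx : x ∈ ⋀[ℝ]^k V) :
    ExteriorAlgebra.ι ℝ z * x ∈ ⋀[ℝ]^(k + 1) V := by
  rw [add_comm]
  refine SetLike.GradedMul.mul_mem (A := fun i : ℕ => ⋀[ℝ]^i V) ?_ hx
  simp

/-- grade projection in the exterior algebra -/
abbrev eproj (k : ℕ) : ExteriorAlgebra ℝ V →ₗ[ℝ] ExteriorAlgebra ℝ V :=
  GradedAlgebra.proj (fun i : ℕ => ⋀[ℝ]^i V) k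

theorem eproj_same {k : ℕ} {x : ExteriorAlgebra ℝ V} (hx : x ∈ ⋀[ℝ]^k V) : eproj k x = x := by
  rw [eproj, GradedAlgebra.proj_apply]
  exact DirectSum.decompose_of_mem_same (fun i : ℕ => ⋀[ℝ]^i V) hx

theorem eproj_ne {j k : ℕ} {x : ExteriorAlgebra ℝ V} (hx : x ∈ ⋀[ℝ]^k V) (h : k ≠ j) :
    eproj j x = 0 := by
  rw [eproj, GradedAlgebra.proj_apply]
  exact DirectSum.decompose_of_mem_ne (fun i : ℕ => ⋀[ℝ]^i V) hx h

theorem grade_sep {k : ℕ} {x y : ExteriorAlgebra ℝ V} (hx : x ∈ ⋀[ℝ]^k V)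
    (hy : y ∈ ⋀[ℝ]^(k + 1) V) (h : x + y = 0) : x = 0 ∧ y = 0 := by
  have h1 := congrArg (eproj k) h
  rw [map_add, eproj_same hx, eproj_ne hy (by omega), add_zero, map_zero] at h1
  refine ⟨h1, ?_⟩
  rwa [h1, zero_add] at h

theorem classification (u : Fin n → V) (z : V)
    (hspan : ∀ w : V, ∃ (c : Fin n → ℝ) (d : ℝ), w = ∑ i, c i • u i + d • z)
    (φ : ExteriorAlgebra ℝ V →ₗ[ℝ] ExteriorAlgebra ℝ V)
    (H1 : ∀ i, ∃ g : V →ₗ[ℝ] V, Comm φ g ∧ g (u i) = -u i ∧ (∀ j, j ≠ i → g (u j) = u j) ∧ g z = z)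
    (H2 : ∀ σ : Equiv.Perm (Fin n), ∃ s : V →ₗ[ℝ] V, Comm φ s ∧ (∀ i, s (u i) = u (σ i)) ∧ s z = z)
    (H3 : ∀ i, ∃ g : V →ₗ[ℝ] V, Comm φ g ∧ g (u i) = u i + z ∧ (∀ j, j ≠ i → g (u j) = u j) ∧
      g z = z)
    (H4 : z = 0 ∨ (0 < n ∧ ∀ i, ∃ h : V →ₗ[ℝ] V, h z = u i ∧ ∀ j, j ≠ i → h (u j) = u j)) :
    ∃ a b : ℕ → ℝ, ∀ x, φ x = ∑ k ∈ Finset.range (n + 2),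
      (a k • eproj k x + b k • (ExteriorAlgebra.ι ℝ z * eproj k x)) := by
  choose g hg hgi hgj hgz using H1
  choose a b hab using uniform_coeff u z hspan φ g hg hgi hgj hgz H2 1 (by simp)
  choose c d hcd using uniform_coeff u z hspan φ g hg hgi hgj hgz H2 (ExteriorAlgebra.ι ℝ z)
    (fun s hs => by simp [hs])
  simp only [one_mul] at hab
  let a' : ℕ → ℝ := fun k => if k = n + 1 then d n else a k
  have hlen : ∀ L : List (Fin n), L.Nodup → L.length ≤ n := fun L hL => by
    simpa using hL.length_le_card
  have hz : ∀ L : List (Fin n), L.Nodup → φ (ExteriorAlgebra.ι ℝ z * mono u L) =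
      a' (L.length + 1) • (ExteriorAlgebra.ι ℝ z * mono u L) := by
    intro L hL
    rcases H4 with h0 | ⟨hn, H4⟩
    · simp [h0]
    have h1 := hcd L.length L hL rfl
    by_cases hfull : ∀ i, i ∈ L
    · have hLn : L.length = n := by
        refine le_antisymm (hlen L hL) ?_
        have : (Finset.univ : Finset (Fin n)) ⊆ L.toFinset := fun i _ => by simpa using hfull i
        have := Finset.card_le_card this
        rw [Finset.card_univ, Fintype.card_fin] at this
        exact this.trans (List.toFinset_card_le L)
      have ha' : a' (L.length + 1) = d L.length := by simp [a', hLn]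
      rw [h1, ha']
      cases L with
      | nil => simp at hLn; omega
      | cons i M =>
        obtain ⟨hiM, hM⟩ := List.nodup_cons.1 hL
        obtain ⟨t, ht, hti, htj, htz⟩ := H3 i
        have hneq : ∀ j ∈ M, j ≠ i := fun j hj e => hiM (e ▸ hj)
        have htM : ExteriorAlgebra.map t (mono u M) = mono u M :=
          map_mono_congr _ _ _ _ fun j hj => htj j (hneq j hj)
        have htL : ExteriorAlgebra.map t (mono u (i :: M)) =
            mono u (i :: M) + ExteriorAlgebra.ι ℝ z * mono u M := by
          rw [mono_cons, map_mul, htM, ExteriorAlgebra.map_apply_ι, hti, map_add, add_mul]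
        have htzL : ExteriorAlgebra.map t (ExteriorAlgebra.ι ℝ z * mono u (i :: M)) =
            ExteriorAlgebra.ι ℝ z * mono u (i :: M) := by
          rw [map_mul, htL, ExteriorAlgebra.map_apply_ι, htz, mul_add, ι_sq_mul, add_zero]
        have h2 := ht (ExteriorAlgebra.ι ℝ z * mono u (i :: M))
        rw [htzL, h1, map_add, map_smul, map_smul, htzL, htL] at h2
        have h3 : c (i :: M).length • (ExteriorAlgebra.ι ℝ z * mono u M) = 0 := by
          rw [smul_add] at h2
          have := add_right_cancel h2
          exact (left_eq_add.1 this)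
        obtain ⟨h, hhz, hhj⟩ := H4 i
        have h4 := congrArg (ExteriorAlgebra.map h) h3
        rw [map_smul, map_mul, map_mono_congr u u h M (fun j hj => hhj j (hneq j hj)),
          ExteriorAlgebra.map_apply_ι, hhz, map_zero, ← mono_cons] at h4
        rw [h4, zero_add]
    · push Not at hfull
      obtain ⟨i, hi⟩ := hfull
      have hiL : (i :: L).Nodup := List.nodup_cons.2 ⟨hi, hL⟩
      have hlt := hlen _ hiL
      rw [List.length_cons] at hlt
      have ha' : a' (L.length + 1) = a (L.length + 1) := by
        simp only [a']; rw [if_neg (by omega)]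
      obtain ⟨t, ht, hti, htj, htz⟩ := H3 i
      have hneq : ∀ j ∈ L, j ≠ i := fun j hj e => hi (e ▸ hj)
      have htM : ExteriorAlgebra.map t (mono u L) = mono u L :=
        map_mono_congr _ _ _ _ fun j hj => htj j (hneq j hj)
      have htL : ExteriorAlgebra.map t (mono u (i :: L)) =
          mono u (i :: L) + ExteriorAlgebra.ι ℝ z * mono u L := by
        rw [mono_cons, map_mul, htM, ExteriorAlgebra.map_apply_ι, hti, map_add, add_mul]
      have h2 := ht (mono u (i :: L))
      have h5 := hab (L.length + 1) (i :: L) hiL rfl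
      have htzL : ExteriorAlgebra.map t (ExteriorAlgebra.ι ℝ z * mono u (i :: L)) =
          ExteriorAlgebra.ι ℝ z * mono u (i :: L) := by
        rw [map_mul, htL, ExteriorAlgebra.map_apply_ι, htz, mul_add, ι_sq_mul, add_zero]
      rw [htL, map_add, h5, h1, map_add, map_smul, map_smul, htzL, htL] at h2
      have h6 : c L.length • mono u L +
          (d L.length - a (L.length + 1)) • (ExteriorAlgebra.ι ℝ z * mono u L) = 0 := by
        rw [sub_smul]
        rw [smul_add] at h2
        rw [← sub_eq_zero] at h2
        rw [← h2]
        abel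
      obtain ⟨h7, h8⟩ := grade_sep (Submodule.smul_mem _ _ (mono_mem u L))
        (Submodule.smul_mem _ _ (ι_mul_mem z (mono_mem u L))) h6
      rw [h1, h7, ha', zero_add]
      rwa [sub_smul, sub_eq_zero] at h8
  refine ⟨a', b, ?_⟩
  let F : ExteriorAlgebra ℝ V →ₗ[ℝ] ExteriorAlgebra ℝ V := ∑ k ∈ Finset.range (n + 2),
      (a' k • eproj k + b k • ((LinearMap.mulLeft ℝ (ExteriorAlgebra.ι ℝ z)) ∘ₗ eproj k))
  have hF : ∀ x, F x = ∑ k ∈ Finset.range (n + 2),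
      (a' k • eproj k x + b k • (ExteriorAlgebra.ι ℝ z * eproj k x)) := by
    intro x
    simp only [F, LinearMap.sum_apply, LinearMap.add_apply, LinearMap.smul_apply,
      LinearMap.comp_apply, LinearMap.mulLeft_apply]
  have hFk : ∀ k, k < n + 2 → ∀ x ∈ ⋀[ℝ]^k V,
      F x = a' k • x + b k • (ExteriorAlgebra.ι ℝ z * x) := by
    intro k hk x hx
    rw [hF, Finset.sum_eq_single_of_mem k (Finset.mem_range.2 hk), eproj_same hx]
    intro j _ hj
    rw [eproj_ne hx (Ne.symm hj)]; simp
  intro x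
  rw [← hF]
  have hx := span_monoSet u z hspan [] x
  induction hx using Submodule.span_induction with
  | zero => simp
  | add x y _ _ h1 h2 => rw [map_add, map_add, h1, h2]
  | smul r x _ h => rw [map_smul, map_smul, h]
  | mem x hx =>
    obtain ⟨M, hM, -, hx⟩ := hx
    have := hlen M hM
    rcases hx with rfl | rfl
    · rw [hFk M.length (by omega) _ (mono_mem u M), hab _ M hM rfl]
      simp only [a']
      rw [if_neg (by omega)]
    · rw [hFk (M.length + 1) (by omega) _ (ι_mul_mem z (mono_mem u M)), hz M hM, ι_sq_mul,
        smul_zero, add_zero]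

end AbstractClassification

section Transport

/-- The reflection in a unit vector. -/
def reflL {V : Type*} [AddCommGroup V] [Module ℝ V] (Q : QuadraticForm ℝ V) (v : V) : V →ₗ[ℝ] V :=
  LinearMap.id - (QuadraticMap.polarBilin Q v).smulRight v

theorem reflL_apply {V : Type*} [AddCommGroup V] [Module ℝ V] (Q : QuadraticForm ℝ V) (v x : V) :
    reflL Q v x = x - QuadraticMap.polar Q v x • v := rfl

theorem reflL_isom {V : Type*} [AddCommGroup V] [Module ℝ V] (Q : QuadraticForm ℝ V) (v : V)
    (hv : Q v = 1) (x : V) : Q (reflL Q v x) = Q x := by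
  rw [reflL_apply, sub_eq_add_neg, QuadraticMap.map_add Q, ← neg_smul, QuadraticMap.map_smul, hv,
    QuadraticMap.polar_smul_right, QuadraticMap.polar_comm Q x v]
  simp

/-- The reflection as an isometry. -/
def reflI {V : Type*} [AddCommGroup V] [Module ℝ V] (Q : QuadraticForm ℝ V) (v : V)
    (hv : Q v = 1) : Q →qᵢ Q :=
  { reflL Q v with map_app' := reflL_isom Q v hv }

theorem contractLeft_map {V : Type*} [AddCommGroup V] [Module ℝ V] (g : V →ₗ[ℝ] V)
    (d : Module.Dual ℝ V) (x : ExteriorAlgebra ℝ V) :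
    contractLeft (Q := (0 : QuadraticForm ℝ V)) d (ExteriorAlgebra.map g x) =
      ExteriorAlgebra.map g (contractLeft (Q := (0 : QuadraticForm ℝ V)) (d ∘ₗ g) x) := by
  induction x using CliffordAlgebra.left_induction with
  | algebraMap r =>
    rw [AlgHom.commutes, contractLeft_algebraMap, contractLeft_algebraMap, map_zero]
  | add x y hx hy => simp only [map_add, hx, hy]
  | ι_mul x m hx =>
    have hm : ∀ a b : CliffordAlgebra (0 : QuadraticForm ℝ V), ExteriorAlgebra.map g (a * b) =
      ExteriorAlgebra.map g a * ExteriorAlgebra.map g b := map_mul (ExteriorAlgebra.map g)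
    have : ExteriorAlgebra.map g (ι (0 : QuadraticForm ℝ V) m) =
      ι (0 : QuadraticForm ℝ V) (g m) := ExteriorAlgebra.map_apply_ι g m
    rw [hm, this]
    erw [contractLeft_ι_mul, hx, contractLeft_ι_mul, map_sub, map_smul]
    rw [hm, this]
    rfl

theorem changeForm_map {V : Type*} [AddCommGroup V] [Module ℝ V] (Q : QuadraticForm ℝ V)
    (B : LinearMap.BilinForm ℝ V) (h : B.toQuadraticMap = (0 : QuadraticForm ℝ V) - Q)
    (g : Q →qᵢ Q) (hB : ∀ x y, B (g x) (g y) = B x y) (x : CliffordAlgebra Q) :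
    changeForm h (CliffordAlgebra.map g x) =
      ExteriorAlgebra.map g.toLinearMap (changeForm h x) := by
  induction x using CliffordAlgebra.left_induction with
  | algebraMap r =>
    rw [AlgHom.commutes, changeForm_algebraMap]
    exact (AlgHom.commutes (ExteriorAlgebra.map g.toLinearMap) r).symm
  | add x y hx hy => simp only [map_add, hx, hy]
  | ι_mul x m hx =>
    have h1 : ExteriorAlgebra.map g.toLinearMap (ι (0 : QuadraticForm ℝ V) m) =
      ι (0 : QuadraticForm ℝ V) (g m) := ExteriorAlgebra.map_apply_ι g.toLinearMap m
    have h2 : B m = (B (g m)) ∘ₗ g.toLinearMap := by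
      ext y; exact (hB m y).symm
    rw [map_mul, map_apply_ι, changeForm_ι_mul, changeForm_ι_mul, hx]
    erw [map_sub, map_mul]
    rw [h1, h2]
    erw [contractLeft_map]

variable {n r : ℕ}

theorem gaToExt_map (g : gaForm n r →qᵢ gaForm n r) (x : GA n r) :
    gaToExt n r (CliffordAlgebra.map g x) =
      ExteriorAlgebra.map g.toLinearMap (gaToExt n r x) := by
  refine changeForm_map (gaForm n r) _ changeForm.associated_neg_proof g ?_ x
  intro x y
  rw [QuadraticMap.associated_apply, QuadraticMap.associated_apply, ← map_add]
  simp only [neg_apply, QuadraticMap.Isometry.map_app]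

theorem pinAction_single (v : Fin (n + r) → ℝ) (hv : gaForm n r v = 1) (x : GA n r) :
    pinAction n r [v] x = CliffordAlgebra.map (reflI (gaForm n r) v hv) x := by
  have hvv : ι (gaForm n r) v * ι (gaForm n r) v = 1 := by
    rw [ι_sq_scalar, hv, map_one]
  have hp : ∀ x, pinAction n r [v] x = ι (gaForm n r) v * involute x * ι (gaForm n r) v := by
    intro x; simp [pinAction, versor]
  rw [hp]
  induction x using CliffordAlgebra.left_induction with
  | algebraMap c =>
    rw [AlgHom.commutes, AlgHom.commutes, ← Algebra.commutes, mul_assoc, hvv, mul_one]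
  | add x y hx hy => simp only [map_add, mul_add, add_mul, hx, hy]
  | ι_mul x m hx =>
    rw [map_mul, map_mul, involute_ι, ← hx, map_apply_ι]
    have : reflI (gaForm n r) v hv m = m - QuadraticMap.polar (gaForm n r) v m • v := rfl
    rw [this, map_sub, map_smul]
    have h3 : ι (gaForm n r) v * ι (gaForm n r) m =
        algebraMap ℝ _ (QuadraticMap.polar (gaForm n r) v m) - ι (gaForm n r) m * ι (gaForm n r) v :=
      eq_sub_of_add_eq (ι_mul_ι_add_swap v m)
    have h4 : ι (gaForm n r) v * (-ι (gaForm n r) m * involute x) * ι (gaForm n r) v =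
      -((ι (gaForm n r) v * ι (gaForm n r) m) * (involute x * ι (gaForm n r) v)) := by noncomm_ring
    rw [h4, h3, sub_mul, sub_mul, smul_mul_assoc, ← Algebra.smul_def]
    have h5 : ι (gaForm n r) v * (ι (gaForm n r) v * involute x * ι (gaForm n r) v) =
        involute x * ι (gaForm n r) v := by
      rw [← mul_assoc, ← mul_assoc, hvv, one_mul]
    rw [h5]
    simp only [mul_assoc]
    rw [neg_sub]

theorem pinAction_nil (x : GA n r) : pinAction n r [] x = x := by simp [pinAction, versor]

theorem involute_iter_mul (k : ℕ) (a b : GA n r) :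
    (⇑(involute (Q := gaForm n r)))^[k] (a * b) =
      (⇑(involute (Q := gaForm n r)))^[k] a * (⇑(involute (Q := gaForm n r)))^[k] b := by
  induction k with
  | zero => rfl
  | succ k ih => rw [Function.iterate_succ_apply', Function.iterate_succ_apply',
      Function.iterate_succ_apply', ih, map_mul]

theorem pinAction_cons (v : Fin (n + r) → ℝ) (l : List (Fin (n + r) → ℝ)) (x : GA n r) :
    pinAction n r (v :: l) x = pinAction n r [v] (pinAction n r l x) := by
  have h1 : involute (versor n r l) = (-1 : ℝ) ^ l.length • versor n r l :=
    involute_prod_map_ι l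
  have h2 : involute (reverse (versor n r l)) = (-1 : ℝ) ^ l.length • reverse (versor n r l) := by
    rw [← reverse_involute, h1, map_smul]
  have h3 : versor n r (v :: l) = ι (gaForm n r) v * versor n r l := by simp [versor]
  have h4 : versor n r [v] = ι (gaForm n r) v := by simp [versor]
  simp only [pinAction]
  rw [h3, h4, List.length_cons, Function.iterate_succ_apply']
  simp only [List.length_singleton, Function.iterate_one, map_mul, h1, h2, reverse.map_mul,
    reverse_ι, smul_mul_assoc, mul_smul_comm, smul_smul]
  rw [← mul_pow]
  simp [mul_assoc]

/-- Conjugation of a linear map to the exterior algebra. -/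
def toE (ψ : GA n r →ₗ[ℝ] GA n r) :
    ExteriorAlgebra ℝ (Fin (n + r) → ℝ) →ₗ[ℝ] ExteriorAlgebra ℝ (Fin (n + r) → ℝ) :=
  (gaToExt n r).toLinearMap ∘ₗ ψ ∘ₗ (gaToExt n r).symm.toLinearMap

theorem toE_apply (ψ : GA n r →ₗ[ℝ] GA n r) (x : GA n r) :
    toE ψ (gaToExt n r x) = gaToExt n r (ψ x) := by simp [toE]

theorem gaToExt_single (v : Fin (n + r) → ℝ) (hv : gaForm n r v = 1) (x : GA n r) :
    gaToExt n r (pinAction n r [v] x) =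
      ExteriorAlgebra.map (reflL (gaForm n r) v) (gaToExt n r x) := by
  rw [pinAction_single v hv, gaToExt_map]; rfl

theorem equivariant_iff (ψ : GA n r →ₗ[ℝ] GA n r) :
    IsPinEquivariant n r ψ ↔
      ∀ v, gaForm n r v = 1 → Comm (toE ψ) (reflL (gaForm n r) v) := by
  constructor
  · intro h v hv y
    obtain ⟨x, rfl⟩ := (gaToExt n r).surjective y
    rw [← gaToExt_single v hv, toE_apply, toE_apply, h [v] (by intro w hw; simp_all),
      gaToExt_single v hv]
  · intro h l
    induction l with
    | nil => intro _ x; rw [pinAction_nil, pinAction_nil]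
    | cons v l ih =>
      intro hl x
      have hv : gaForm n r v = 1 := hl v List.mem_cons_self
      rw [pinAction_cons v l x, pinAction_cons v l (ψ x), ← ih (fun w hw => hl w (List.mem_cons_of_mem _ hw))]
      apply (gaToExt n r).injective
      rw [← toE_apply, gaToExt_single v hv, gaToExt_single v hv, h v hv, toE_apply]

end Transport

section Concrete

/-- the nondegenerate basis vectors -/
def uu (n r : ℕ) (i : Fin n) : Fin (n + r) → ℝ := Pi.single (Fin.castAdd r i) 1

/-- the sum of the degenerate basis vectors (`e_0` if `r = 1`, and `0` if `r = 0`) -/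
def zz (n r : ℕ) : Fin (n + r) → ℝ := fun j => if n ≤ (j : ℕ) then 1 else 0

variable {n r : ℕ}

theorem uu_apply (i j : Fin n) : uu n r i (Fin.castAdd r j) = if j = i then 1 else 0 := by
  simp [uu, Pi.single_apply]

theorem zz_apply (j : Fin n) : zz n r (Fin.castAdd r j) = 0 := by
  simp [zz]

theorem gaForm_eq (v : Fin (n + r) → ℝ) :
    gaForm n r v = ∑ i : Fin n, v (Fin.castAdd r i) * v (Fin.castAdd r i) := by
  rw [gaForm, QuadraticMap.weightedSumSquares_apply, Fin.sum_univ_add]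
  simp

theorem polar_eq (v x : Fin (n + r) → ℝ) :
    QuadraticMap.polar (gaForm n r) v x =
      ∑ i : Fin n, 2 * v (Fin.castAdd r i) * x (Fin.castAdd r i) := by
  rw [QuadraticMap.polar, gaForm_eq, gaForm_eq, gaForm_eq, ← Finset.sum_sub_distrib,
    ← Finset.sum_sub_distrib]
  refine Finset.sum_congr rfl fun i _ => ?_
  simp only [Pi.add_apply]
  ring

theorem refl_zz (v : Fin (n + r) → ℝ) : reflL (gaForm n r) v (zz n r) = zz n r := by
  rw [reflL_apply, polar_eq]
  simp [zz_apply]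

theorem refl_uu (v : Fin (n + r) → ℝ) (i : Fin n) : reflL (gaForm n r) v (uu n r i) =
    uu n r i - (2 * v (Fin.castAdd r i)) • v := by
  rw [reflL_apply, polar_eq]
  simp [uu_apply]

theorem zz_zero (n : ℕ) : zz n 0 = 0 := by
  ext j
  have := j.2
  simp [zz]

theorem zz_last (n : ℕ) : zz n 1 (Fin.last n) = 1 := by simp [zz]

theorem gaForm_zz : gaForm n r (zz n r) = 0 := by
  rw [gaForm_eq]; simp [zz_apply]

theorem hspan_ga (hr : r = 0 ∨ r = 1) (w : Fin (n + r) → ℝ) :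
    ∃ (c : Fin n → ℝ) (d : ℝ), w = ∑ i, c i • uu n r i + d • zz n r := by
  rcases hr with rfl | rfl
  · refine ⟨fun i => w (Fin.castAdd 0 i), 0, ?_⟩
    ext j
    refine Fin.addCases (fun i => ?_) (fun i => i.elim0) j
    simp only [Pi.add_apply, Finset.sum_apply, Pi.smul_apply, uu_apply, zz_apply]
    simp
  · refine ⟨fun i => w (Fin.castAdd 1 i), w (Fin.last n), ?_⟩
    ext j
    refine Fin.addCases (fun i => ?_) (fun i => ?_) j
    · simp only [Pi.add_apply, Finset.sum_apply, Pi.smul_apply, uu_apply, zz_apply]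
      simp
    · have : Fin.natAdd n i = Fin.last n := by
        ext; simp
      rw [this]
      simp only [Pi.add_apply, Finset.sum_apply, Pi.smul_apply, zz_last]
      have h2 : ∀ k : Fin n, uu n 1 k (Fin.last n) = 0 := by
        intro k
        rw [uu, Pi.single_apply, if_neg]
        intro h
        have := congrArg Fin.val h
        simp at this
        have := k.2
        omega
      simp [h2]

theorem unit_uu (i : Fin n) (t : ℝ) : gaForm n r (uu n r i + t • zz n r) = 1 := by
  rw [gaForm_eq]
  simp [uu_apply, zz_apply]

theorem refl_uut (i j : Fin n) (t : ℝ) : reflL (gaForm n r) (uu n r i + t • zz n r) (uu n r j) =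
    if j = i then - uu n r i - (2 * t) • zz n r else uu n r j := by
  rw [refl_uu]
  simp only [Pi.add_apply, Pi.smul_apply, uu_apply, zz_apply, smul_zero, add_zero]
  split_ifs with h
  · subst h; module
  · simp

theorem classification_ga (h : r = 0 ∨ (r = 1 ∧ 0 < n)) (φ : GA n r →ₗ[ℝ] GA n r)
    (hφ : IsPinEquivariant n r φ) :
    ∃ a b : ℕ → ℝ, ∀ x, toE φ x = ∑ k ∈ Finset.range (n + 2),
      (a k • eproj k x + b k • (ExteriorAlgebra.ι ℝ (zz n r) * eproj k x)) := by
  have hr : r = 0 ∨ r = 1 := h.imp id And.left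
  rw [equivariant_iff] at hφ
  have hflip : ∀ i (t : ℝ), Comm (toE φ) (reflL (gaForm n r) (uu n r i + t • zz n r)) :=
    fun i t => hφ _ (unit_uu i t)
  refine classification (uu n r) (zz n r) (hspan_ga hr) (toE φ) ?_ ?_ ?_ ?_
  · intro i
    refine ⟨_, hflip i 0, ?_, ?_, refl_zz _⟩
    · rw [refl_uut]; simp
    · intro j hj
      rw [refl_uut, if_neg hj]
  · intro σ
    induction σ using Equiv.Perm.swap_induction_on with
    | one => exact ⟨LinearMap.id, fun x => by simp [ExteriorAlgebra.map_id], by simp, rfl⟩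
    | swap_mul σ i j hij ih =>
      obtain ⟨s, hs, hsu, hsz⟩ := ih
      set c : ℝ := (Real.sqrt 2)⁻¹ with hc
      have hcc : c * c = 1 / 2 := by
        rw [hc, ← mul_inv, Real.mul_self_sqrt (by norm_num)]; norm_num
      have hv : gaForm n r (c • (uu n r i - uu n r j)) = 1 := by
        rw [QuadraticMap.map_smul, hcc, gaForm_eq]
        have : ∀ k : Fin n, (uu n r i - uu n r j) (Fin.castAdd r k) *
            (uu n r i - uu n r j) (Fin.castAdd r k) =
            (if k = i then 1 else 0) + (if k = j then (1 : ℝ) else 0) := by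
          intro k
          simp only [Pi.sub_apply, uu_apply]
          by_cases h1 : k = i <;> by_cases h2 : k = j <;> simp_all
        simp only [this, Finset.sum_add_distrib]
        simp; norm_num
      refine ⟨_, (hφ _ hv).comp hs, ?_, ?_⟩
      · intro k
        rw [LinearMap.comp_apply, hsu, refl_uu, Equiv.Perm.mul_apply]
        simp only [Pi.smul_apply, Pi.sub_apply, uu_apply, smul_eq_mul]
        rw [smul_smul]
        have : ∀ e : ℝ, 2 * (c * e) * c = e := fun e => by
          have : 2 * (c * e) * c = 2 * (c * c) * e := by ring
          rw [this, hcc]; ring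
        rw [this]
        by_cases h1 : σ k = i
        · rw [h1, Equiv.swap_apply_left, if_pos rfl, if_neg hij]
          module
        · by_cases h2 : σ k = j
          · rw [h2, Equiv.swap_apply_right, if_pos rfl, if_neg (Ne.symm hij)]
            module
          · rw [Equiv.swap_apply_of_ne_of_ne h1 h2, if_neg h1, if_neg h2]
            module
      · rw [LinearMap.comp_apply, hsz, refl_zz]
  · intro i
    refine ⟨_, (hflip i 0).comp (hflip i (-1/2)), ?_, ?_, ?_⟩
    · rw [LinearMap.comp_apply, refl_uut, if_pos rfl, map_sub, map_neg, map_smul, refl_zz,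
        refl_uut, if_pos rfl]
      module
    · intro j hj
      rw [LinearMap.comp_apply, refl_uut, if_neg hj, refl_uut, if_neg hj]
    · rw [LinearMap.comp_apply, refl_zz, refl_zz]
  · rcases h with rfl | ⟨rfl, hn⟩
    · exact Or.inl (zz_zero n)
    · refine Or.inr ⟨hn, fun i => ?_⟩
      refine ⟨LinearMap.id + (LinearMap.proj (Fin.last n)).smulRight (uu n 1 i - zz n 1), ?_, ?_⟩
      · simp [zz_last]
      · intro j _
        have h2 : uu n 1 j (Fin.last n) = 0 := by
          rw [uu, Pi.single_apply, if_neg]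
          intro h
          have := congrArg Fin.val h
          simp at this
          have := j.2
          omega
        simp [h2]

theorem map_mem_grade {V : Type*} [AddCommGroup V] [Module ℝ V] (g : V →ₗ[ℝ] V) {k : ℕ}
    {x : ExteriorAlgebra ℝ V} (hx : x ∈ ⋀[ℝ]^k V) : ExteriorAlgebra.map g x ∈ ⋀[ℝ]^k V := by
  have h1 : ExteriorAlgebra.map g x ∈
      Submodule.map (ExteriorAlgebra.map g).toLinearMap (⋀[ℝ]^k V) := ⟨x, hx, rfl⟩
  rw [Submodule.map_pow] at h1
  refine pow_le_pow_left' (M := Submodule ℝ (ExteriorAlgebra ℝ V)) ?_ k h1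
  rintro _ ⟨_, ⟨m, rfl⟩, rfl⟩
  exact ⟨g m, (ExteriorAlgebra.map_apply_ι g m).symm⟩

theorem eproj_comm {V : Type*} [AddCommGroup V] [Module ℝ V] (g : V →ₗ[ℝ] V) (k : ℕ) :
    Comm (eproj k) g := by
  intro x
  induction x using DirectSum.Decomposition.inductionOn (fun i : ℕ => ⋀[ℝ]^i V) with
  | zero => simp
  | @homogeneous i m =>
    by_cases h : i = k
    · subst h
      rw [eproj_same m.2, eproj_same (map_mem_grade g m.2)]
    · rw [eproj_ne m.2 h, eproj_ne (map_mem_grade g m.2) h, map_zero]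
  | add x y hx hy => simp only [map_add, hx, hy]

theorem gaToExt_gradeProj (k : ℕ) (x : GA n r) :
    gaToExt n r (gradeProj n r k x) = eproj k (gaToExt n r x) := by
  simp [gradeProj, -GradedAlgebra.proj_apply]

theorem toE_gradeProj (k : ℕ) : toE (gradeProj n r k) = eproj k := by
  refine LinearMap.ext fun y => ?_
  obtain ⟨x, rfl⟩ := (gaToExt n r).surjective y
  rw [toE_apply, gaToExt_gradeProj]

/-- left wedge multiplication by the degenerate vector -/
def zWedge (n r : ℕ) : GA n r →ₗ[ℝ] GA n r :=
  (gaToExt n r).symm.toLinearMap ∘ₗ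
    (LinearMap.mulLeft ℝ (ExteriorAlgebra.ι ℝ (zz n r))) ∘ₗ (gaToExt n r).toLinearMap

theorem gaToExt_zWedge (x : GA n r) :
    gaToExt n r (zWedge n r x) = ExteriorAlgebra.ι ℝ (zz n r) * gaToExt n r x := by
  simp [zWedge]

theorem gaToExt_ι (v : Fin (n + r) → ℝ) :
    gaToExt n r (ι (gaForm n r) v) = ExteriorAlgebra.ι ℝ v :=
  changeForm_ι changeForm.associated_neg_proof v

theorem gaToExt_one : gaToExt n r 1 = 1 := changeForm_one changeForm.associated_neg_proof

theorem gaToExt_wedge (x y : GA n r) :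
    gaToExt n r (wedge n r x y) = gaToExt n r x * gaToExt n r y := by simp [wedge]

theorem zWedge_eq (x : GA n r) : zWedge n r x = wedge n r (ι (gaForm n r) (zz n r)) x := by
  apply (gaToExt n r).injective
  rw [gaToExt_zWedge, gaToExt_wedge, gaToExt_ι]

theorem blade_mem (vs : List (Fin (n + r) → ℝ)) :
    gaToExt n r (bladeList n r vs) ∈ ⋀[ℝ]^(vs.length) (Fin (n + r) → ℝ) := by
  induction vs with
  | nil =>
    rw [bladeList, List.foldr_nil, gaToExt_one]
    exact SetLike.GradedOne.one_mem (A := fun i : ℕ => ⋀[ℝ]^i (Fin (n + r) → ℝ))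
  | cons v vs ih =>
    rw [bladeList, List.foldr_cons, gaToExt_wedge, gaToExt_ι]
    exact ι_mul_mem v ih

theorem isBlade_mem {k : ℕ} {x : GA n r} (hx : IsBlade n r k x) :
    gaToExt n r x ∈ ⋀[ℝ]^k (Fin (n + r) → ℝ) := by
  obtain ⟨c, vs, rfl, rfl⟩ := hx
  rw [map_smul]
  exact Submodule.smul_mem _ _ (blade_mem vs)

theorem isBlade_proj {k : ℕ} {x : GA n r} (hx : IsBlade n r k x) : gradeProj n r k x = x := by
  apply (gaToExt n r).injective
  rw [gaToExt_gradeProj, eproj_same (isBlade_mem hx)]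

theorem IsBlade.smul {k : ℕ} {x : GA n r} (hx : IsBlade n r k x) (a : ℝ) :
    IsBlade n r k (a • x) := by
  obtain ⟨c, vs, rfl, rfl⟩ := hx
  exact ⟨a * c, vs, rfl, by rw [smul_smul]⟩

theorem IsBlade.zWedge {k : ℕ} {x : GA n r} (hx : IsBlade n r k x) :
    IsBlade n r (k + 1) (zWedge n r x) := by
  obtain ⟨c, vs, rfl, rfl⟩ := hx
  refine ⟨c, zz n r :: vs, rfl, ?_⟩
  rw [map_smul, zWedge_eq]
  rfl

theorem gradeProj_idem (k : ℕ) (x : GA n r) :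
    gradeProj n r k (gradeProj n r k x) = gradeProj n r k x := by
  apply (gaToExt n r).injective
  rw [gaToExt_gradeProj, gaToExt_gradeProj, eproj_same]
  rw [GradedAlgebra.proj_apply]
  exact SetLike.coe_mem _

/-- The decomposition statement. -/
def Decomp (φ : GA n r →ₗ[ℝ] GA n r) : Prop :=
  ∃ (N : ℕ) (ψ : Fin N → (GA n r →ₗ[ℝ] GA n r)) (ks ls : Fin N → ℕ),
      (∀ x, φ x = ∑ i, ψ i x) ∧
        ∀ i : Fin N,
          IsPinEquivariant n r (ψ i) ∧
            (∀ x, ψ i x = ψ i (gradeProj n r (ks i) x)) ∧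
              (∀ x, IsBlade n r (ks i) x → IsBlade n r (ls i) (ψ i x))

theorem decomp_of_fintype {I : Type} [Fintype I] (φ : GA n r →ₗ[ℝ] GA n r)
    (ψ : I → (GA n r →ₗ[ℝ] GA n r)) (ks ls : I → ℕ) (h1 : ∀ x, φ x = ∑ i, ψ i x)
    (h2 : ∀ i, IsPinEquivariant n r (ψ i) ∧ (∀ x, ψ i x = ψ i (gradeProj n r (ks i) x)) ∧
              (∀ x, IsBlade n r (ks i) x → IsBlade n r (ls i) (ψ i x))) : Decomp φ := by
  let e := Fintype.equivFin I
  refine ⟨Fintype.card I, ψ ∘ e.symm, ks ∘ e.symm, ls ∘ e.symm, ?_, fun i => h2 (e.symm i)⟩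
  intro x
  rw [h1]
  exact (Equiv.sum_comp e.symm (fun i => ψ i x)).symm

theorem Comm.smul {V : Type*} [AddCommGroup V] [Module ℝ V]
    {φ : ExteriorAlgebra ℝ V →ₗ[ℝ] ExteriorAlgebra ℝ V} {g : V →ₗ[ℝ] V}
    (h : Comm φ g) (a : ℝ) : Comm (a • φ) g := by
  intro x
  simp only [LinearMap.smul_apply, map_smul, h x]

theorem equivariant_smul {φ : GA n r →ₗ[ℝ] GA n r} (h : IsPinEquivariant n r φ) (a : ℝ) :
    IsPinEquivariant n r (a • φ) := by
  rw [equivariant_iff] at h ⊢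
  intro v hv
  have : toE (a • φ) = a • toE φ := by
    refine LinearMap.ext fun x => ?_
    simp [toE]
  rw [this]
  exact (h v hv).smul a

theorem equivariant_sub {φ ψ : GA n r →ₗ[ℝ] GA n r} (h : IsPinEquivariant n r φ)
    (h' : IsPinEquivariant n r ψ) : IsPinEquivariant n r (φ - ψ) := by
  rw [equivariant_iff] at h h' ⊢
  intro v hv x
  have : toE (φ - ψ) = toE φ - toE ψ := by
    refine LinearMap.ext fun x => ?_
    simp [toE]
  rw [this, LinearMap.sub_apply, LinearMap.sub_apply, map_sub, h v hv, h' v hv]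

theorem equivariant_gradeProj (k : ℕ) : IsPinEquivariant n r (gradeProj n r k) := by
  rw [equivariant_iff]
  intro v _
  rw [toE_gradeProj]
  exact eproj_comm _ k

theorem equivariant_zWedge (k : ℕ) : IsPinEquivariant n r (zWedge n r ∘ₗ gradeProj n r k) := by
  rw [equivariant_iff]
  intro v _ y
  have : ∀ y, toE (zWedge n r ∘ₗ gradeProj n r k) y =
      ExteriorAlgebra.ι ℝ (zz n r) * eproj k y := by
    intro y
    obtain ⟨x, rfl⟩ := (gaToExt n r).surjective y
    rw [toE_apply, LinearMap.comp_apply, gaToExt_zWedge, gaToExt_gradeProj]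
  rw [this, this, map_mul, ExteriorAlgebra.map_apply_ι, refl_zz, eproj_comm]

theorem decomp_main (h : r = 0 ∨ (r = 1 ∧ 0 < n)) (φ : GA n r →ₗ[ℝ] GA n r)
    (hφ : IsPinEquivariant n r φ) : Decomp φ := by
  obtain ⟨a, b, hab⟩ := classification_ga h φ hφ
  refine decomp_of_fintype (I := Fin (n + 2) ⊕ Fin (n + 2)) φ
    (Sum.elim (fun k => a k • gradeProj n r k) (fun k => b k • (zWedge n r ∘ₗ gradeProj n r k)))
    (Sum.elim (fun k => (k : ℕ)) (fun k => (k : ℕ)))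
    (Sum.elim (fun k => (k : ℕ)) (fun k => (k : ℕ) + 1)) ?_ ?_
  · intro x
    apply (gaToExt n r).injective
    rw [← toE_apply, hab, Fintype.sum_sum_type, Finset.sum_add_distrib, map_add, map_sum, map_sum,
      Finset.sum_range, Finset.sum_range]
    simp only [Sum.elim_inl, Sum.elim_inr, LinearMap.smul_apply, LinearMap.comp_apply, map_smul,
      gaToExt_gradeProj, gaToExt_zWedge]
  · rintro (k | k)
    · refine ⟨equivariant_smul (equivariant_gradeProj _) _, fun x => ?_, fun x hx => ?_⟩
      · simp only [Sum.elim_inl, LinearMap.smul_apply, gradeProj_idem]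
      · simp only [Sum.elim_inl, LinearMap.smul_apply] at hx ⊢
        rw [isBlade_proj hx]
        exact hx.smul _
    · refine ⟨equivariant_smul (equivariant_zWedge _) _, fun x => ?_, fun x hx => ?_⟩
      · simp only [Sum.elim_inr, LinearMap.smul_apply, LinearMap.comp_apply, gradeProj_idem]
      · simp only [Sum.elim_inr, LinearMap.smul_apply, LinearMap.comp_apply] at hx ⊢
        rw [isBlade_proj hx]
        exact hx.zWedge.smul _

theorem zz_top (hr : r = 0 ∨ r = 1) (x : ExteriorAlgebra ℝ (Fin (n + r) → ℝ)) :
    ExteriorAlgebra.ι ℝ (zz n r) * eproj (n + 1) x = 0 := by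
  have hx := span_monoSet (uu n r) (zz n r) (hspan_ga hr) [] x
  induction hx using Submodule.span_induction with
  | zero => simp
  | add x y _ _ h1 h2 => rw [map_add, mul_add, h1, h2, add_zero]
  | smul c x _ h => rw [map_smul, mul_smul_comm, h, smul_zero]
  | mem x hx =>
    obtain ⟨M, hM, -, hx⟩ := hx
    have hlen : M.length ≤ n := by simpa using hM.length_le_card
    rcases hx with rfl | rfl
    · rw [eproj_ne (mono_mem _ M) (by omega), mul_zero]
    · by_cases h : M.length = n
      · have hm := ι_mul_mem (zz n r) (mono_mem (uu n r) M)
        rw [h] at hm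
        rw [eproj_same hm, ι_sq_mul]
      · rw [eproj_ne (ι_mul_mem _ (mono_mem _ M)) (by omega), mul_zero]

theorem unique_main (h : r = 0 ∨ (r = 1 ∧ 0 < n)) (δ : GA n r →ₗ[ℝ] GA n r)
    (hδ : IsPinEquivariant n r δ) (k : ℕ) (hk : ∀ x, δ x = δ (gradeProj n r k x))
    (x₀ : GA n r) (hx₀ : IsBlade n r k x₀) (hne : x₀ ≠ 0)
    (hid : (r = 0 ∨ k < n + 1) → ¬ IsIdealMV n r x₀) (h0 : δ x₀ = 0) : δ = 0 := by
  obtain ⟨a, b, hab⟩ := classification_ga h δ hδ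
  have hr : r = 0 ∨ r = 1 := h.imp id And.left
  have hsum : ∀ Y ∈ ⋀[ℝ]^k (Fin (n + r) → ℝ), toE δ Y = if k < n + 2 then
      a k • Y + b k • (ExteriorAlgebra.ι ℝ (zz n r) * Y) else 0 := by
    intro Y hY
    rw [hab]
    split_ifs with hkn
    · rw [Finset.sum_eq_single_of_mem k (Finset.mem_range.2 hkn), eproj_same hY]
      intro j _ hj
      rw [eproj_ne hY (Ne.symm hj)]; simp
    · refine Finset.sum_eq_zero fun j hj => ?_
      have := Finset.mem_range.1 hj
      rw [eproj_ne hY (by omega)]; simp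
  have hmem : ∀ x : GA n r, gaToExt n r (gradeProj n r k x) ∈ ⋀[ℝ]^k (Fin (n + r) → ℝ) := by
    intro x
    rw [gaToExt_gradeProj, GradedAlgebra.proj_apply]
    exact SetLike.coe_mem _
  ext1 y
  rw [LinearMap.zero_apply, hk]
  apply (gaToExt n r).injective
  rw [map_zero, ← toE_apply, hsum _ (hmem y)]
  split_ifs with hkn
  swap
  · rfl
  have hX := isBlade_mem hx₀
  have hXne : gaToExt n r x₀ ≠ 0 := by simpa using hne
  have h1 := hsum _ hX
  rw [if_pos hkn, toE_apply, h0, map_zero] at h1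
  obtain ⟨h2, h3⟩ := grade_sep (Submodule.smul_mem _ _ hX)
    (Submodule.smul_mem _ _ (ι_mul_mem _ hX)) h1.symm
  have ha : a k = 0 := (smul_eq_zero.1 h2).resolve_right hXne
  rw [ha, zero_smul, zero_add]
  rcases smul_eq_zero.1 h3 with hb | hz
  · rw [hb, zero_smul]
  rcases hr with rfl | rfl
  · rw [zz_zero]; simp
  by_cases hk1 : k = n + 1
  · subst hk1
    rw [gaToExt_gradeProj, zz_top (Or.inr rfl), smul_zero]
  · exfalso
    refine hid (Or.inr (by omega)) ?_
    let d : Module.Dual ℝ (Fin (n + 1) → ℝ) := LinearMap.proj (Fin.last n)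
    have h4 := contractLeft_ι_mul (Q := (0 : QuadraticForm ℝ (Fin (n + 1) → ℝ))) d (zz n 1)
      (gaToExt n 1 x₀)
    have h5 : ι (0 : QuadraticForm ℝ (Fin (n + 1) → ℝ)) (zz n 1) * gaToExt n 1 x₀ = 0 := hz
    have h6 : d (zz n 1) = 1 := zz_last n
    rw [h5, map_zero, h6, one_smul] at h4
    refine ⟨zz n 1, (gaToExt n 1).symm
      (contractLeft (Q := (0 : QuadraticForm ℝ (Fin (n + 1) → ℝ))) d (gaToExt n 1 x₀)), ?_,
      gaForm_zz, ?_⟩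
    · intro h
      have := zz_last n
      rw [h] at this
      simp at this
    · apply (gaToExt n 1).injective
      rw [gaToExt_wedge, gaToExt_ι, LinearEquiv.apply_symm_apply]
      exact sub_eq_zero.1 h4.symm

/-! ### The exceptional case `n = 0`, `r = 1` -/

theorem exc_span (x : ExteriorAlgebra ℝ (Fin (0 + 1) → ℝ)) :
    ∃ α β : ℝ, x = α • 1 + β • ExteriorAlgebra.ι ℝ (zz 0 1) := by
  have hx := span_monoSet (uu 0 1) (zz 0 1) (hspan_ga (Or.inr rfl)) [] x
  have : monoSet (uu 0 1) (zz 0 1) [] ∅ ⊆ {1, ExteriorAlgebra.ι ℝ (zz 0 1)} := by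
    rintro y ⟨M, -, -, hy⟩
    have hM : M = [] := by
      cases M with
      | nil => rfl
      | cons i _ => exact i.elim0
    subst hM
    rw [mono_nil, mul_one] at hy
    exact hy
  obtain ⟨a, b, h⟩ := Submodule.mem_span_pair.1 (Submodule.span_mono this hx)
  exact ⟨a, b, h.symm⟩

theorem exc_equivariant (ψ : GA 0 1 →ₗ[ℝ] GA 0 1) : IsPinEquivariant 0 1 ψ := by
  rw [equivariant_iff]
  intro v hv
  rw [gaForm_eq] at hv
  simp at hv

/-- The blade spanning each grade. -/
def excBlade (k : ℕ) : GA 0 1 := bladeList 0 1 (List.replicate k (zz 0 1))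

theorem excBlade_isBlade (k : ℕ) (c : ℝ) : IsBlade 0 1 k (c • excBlade k) :=
  ⟨c, List.replicate k (zz 0 1), List.length_replicate, rfl⟩

theorem excBlade_zero : excBlade 0 = 1 := rfl

theorem excBlade_one : excBlade 1 = ι (gaForm 0 1) (zz 0 1) := by
  apply (gaToExt 0 1).injective
  change gaToExt 0 1 (wedge 0 1 (ι (gaForm 0 1) (zz 0 1)) 1) = _
  rw [gaToExt_wedge, gaToExt_one, mul_one]

theorem exc_span' (x : GA 0 1) : ∃ α β : ℝ, x = α • excBlade 0 + β • excBlade 1 := by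
  obtain ⟨α, β, h⟩ := exc_span (gaToExt 0 1 x)
  refine ⟨α, β, ?_⟩
  apply (gaToExt 0 1).injective
  rw [h, map_add, map_smul, map_smul, excBlade_zero, excBlade_one, gaToExt_one, gaToExt_ι]

theorem gradeProj_excBlade (j k : ℕ) :
    gradeProj 0 1 j (excBlade k) = if k = j then excBlade k else 0 := by
  have hb : IsBlade 0 1 k (excBlade k) := by simpa using excBlade_isBlade k 1
  split_ifs with h
  · subst h; exact isBlade_proj hb
  · apply (gaToExt 0 1).injective
    rw [gaToExt_gradeProj, eproj_ne (isBlade_mem hb) h, map_zero]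

theorem exc_proj (k : ℕ) (x : GA 0 1) : ∃ c : ℝ, gradeProj 0 1 k x = c • excBlade k := by
  obtain ⟨α, β, rfl⟩ := exc_span' x
  rw [map_add, map_smul, map_smul, gradeProj_excBlade, gradeProj_excBlade]
  by_cases h0 : 0 = k
  · subst h0; exact ⟨α, by simp⟩
  · by_cases h1 : 1 = k
    · subst h1; exact ⟨β, by simp⟩
    · exact ⟨0, by simp [h0, h1]⟩

theorem exc_sum (x : GA 0 1) : x = ∑ k : Fin 2, gradeProj 0 1 k x := by
  obtain ⟨α, β, rfl⟩ := exc_span' x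
  simp [Fin.sum_univ_two, gradeProj_excBlade]

theorem decomp_exc (φ : GA 0 1 →ₗ[ℝ] GA 0 1) : Decomp φ := by
  refine decomp_of_fintype (I := Fin 2 × Fin 2) φ
    (fun p => gradeProj 0 1 p.2 ∘ₗ φ ∘ₗ gradeProj 0 1 p.1) (fun p => p.1) (fun p => p.2) ?_ ?_
  · intro x
    rw [Fintype.sum_prod_type]
    simp only [LinearMap.comp_apply]
    simp only [← exc_sum]
    rw [← map_sum, ← exc_sum]
  · intro p
    refine ⟨exc_equivariant _, fun x => ?_, fun x _ => ?_⟩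
    · simp only [LinearMap.comp_apply, gradeProj_idem]
    · simp only [LinearMap.comp_apply]
      obtain ⟨c, hc⟩ := exc_proj p.2 (φ (gradeProj 0 1 p.1 x))
      rw [hc]
      exact excBlade_isBlade _ _

theorem unique_exc (δ : GA 0 1 →ₗ[ℝ] GA 0 1) (k : ℕ)
    (hk : ∀ x, δ x = δ (gradeProj 0 1 k x))
    (x₀ : GA 0 1) (hx₀ : IsBlade 0 1 k x₀) (hne : x₀ ≠ 0) (h0 : δ x₀ = 0) : δ = 0 := by
  obtain ⟨c, hc⟩ := exc_proj k x₀
  rw [isBlade_proj hx₀] at hc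
  have hc0 : c ≠ 0 := by
    rintro rfl
    exact hne (by rw [hc, zero_smul])
  rw [hc, map_smul, smul_eq_zero] at h0
  have h1 := h0.resolve_left hc0
  ext1 y
  obtain ⟨d, hd⟩ := exc_proj k y
  rw [hk, hd, map_smul, h1, smul_zero, LinearMap.zero_apply]

end Concrete

/-- For `r ∈ {0,1}`, every linear `Pin(n,0,r)`-equivariant map
`φ : G_{n,0,r} → G_{n,0,r}` is a finite sum of linear equivariant maps, each of which
vanishes on all grades other than some `k` and maps `k`-blades to `l`-blades.  Moreover,
such a grade-`k`-supported, blade-to-blade equivariant map is uniquely determined by its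
value on any single nonzero non-ideal `k`-blade (when `r = 0` or `k < n+1`), respectively
on a pseudoscalar, i.e. a nonzero `(n+1)`-blade (when `r = 1` and `k = n+1`). -/
theorem equivariant_linear_maps_decompose_blades_to_blades (n r : ℕ) (hr : r = 0 ∨ r = 1)
    (φ : GA n r →ₗ[ℝ] GA n r) (hφ : IsPinEquivariant n r φ) :
    (∃ (N : ℕ) (ψ : Fin N → (GA n r →ₗ[ℝ] GA n r)) (ks ls : Fin N → ℕ),
      (∀ x, φ x = ∑ i, ψ i x) ∧
        ∀ i : Fin N,
          IsPinEquivariant n r (ψ i) ∧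
            (∀ x, ψ i x = ψ i (gradeProj n r (ks i) x)) ∧
              (∀ x, IsBlade n r (ks i) x → IsBlade n r (ls i) (ψ i x))) ∧
    (∀ (k l : ℕ) (ψ ψ' : GA n r →ₗ[ℝ] GA n r),
      IsPinEquivariant n r ψ → IsPinEquivariant n r ψ' →
      (∀ x, ψ x = ψ (gradeProj n r k x)) → (∀ x, ψ' x = ψ' (gradeProj n r k x)) →
      (∀ x, IsBlade n r k x → IsBlade n r l (ψ x)) →
      (∀ x, IsBlade n r k x → IsBlade n r l (ψ' x)) →
      ∀ x₀ : GA n r, IsBlade n r k x₀ → x₀ ≠ 0 →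
        ((r = 0 ∨ k < n + 1) → ¬ IsIdealMV n r x₀) →
        ψ x₀ = ψ' x₀ → ψ = ψ') := by
  have hcase : (r = 0 ∨ (r = 1 ∧ 0 < n)) ∨ (r = 1 ∧ n = 0) := by omega
  refine ⟨?_, ?_⟩
  · rcases hcase with h | ⟨rfl, rfl⟩
    · exact decomp_main h φ hφ
    · exact decomp_exc φ
  · intro k l ψ ψ' hψ hψ' hk hk' _ _ x₀ hx₀ hne hid heq
    have h0 : (ψ - ψ') x₀ = 0 := by rw [LinearMap.sub_apply, heq, sub_self]
    have hkk : ∀ x, (ψ - ψ') x = (ψ - ψ') (gradeProj n r k x) := by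
      intro x
      rw [LinearMap.sub_apply, LinearMap.sub_apply, hk x, hk' x, ← hk, ← hk']
    rw [← sub_eq_zero]
    rcases hcase with h | ⟨rfl, rfl⟩
    · exact unique_main h _ (equivariant_sub hψ hψ') k hkk x₀ hx₀ hne hid h0
    · exact unique_exc _ k hkk x₀ hx₀ hne h0

end
end

section
/- In the projective geometric algebra G_{n,0,1}, for every Euclidean vector v (a vector with no e_0 component), the element τ = 1 − e_0 v / 2 lies in Spin(n,0,1) and its sandwich action on every multivector x is given by τ[x] = x − e_0 (v ⌋ x), where ⌋ is the left contraction. -/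
open CliffordAlgebra

noncomputable section

/-- The Euclidean pseudoscalar `e_1 e_2 ⋯ e_n`, the geometric product of the
non-degenerate basis vectors. -/
def eucPseudoscalar (n r : ℕ) : GA n r :=
  (((List.finRange (n + r)).filter (fun i : Fin (n + r) => decide ((i : ℕ) < n))).map
    (eVec n r)).prod

/-- In `G_{n,0,1}`, the degenerate basis vector `e_0` (realized as the last coordinate). -/
def e0 (n : ℕ) : GA n 1 := eVec n 1 (Fin.last n)

/-- A vector of the quadratic space is Euclidean if it has no degenerate (`e_0`) component. -/
def IsEuclideanVec (n r : ℕ) (v : Fin (n + r) → ℝ) : Prop :=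
  ∀ i : Fin (n + r), n ≤ (i : ℕ) → v i = 0

/-- A multivector is Euclidean (contains no `e_0`) if it lies in the subalgebra generated
by the Euclidean vectors. -/
def IsEuclidean (n r : ℕ) (x : GA n r) : Prop :=
  x ∈ Algebra.adjoin ℝ {y : GA n r | ∃ v, IsEuclideanVec n r v ∧ y = ι (gaForm n r) v}

theorem aux_contract_zero (m : ℕ) (d : Module.Dual ℝ (Fin m → ℝ))
    (x : ExteriorAlgebra ℝ (Fin m → ℝ)) (hx : x ∈ ⋀[ℝ]^0 (Fin m → ℝ)) :
    contractLeft (Q := (0 : QuadraticForm ℝ (Fin m → ℝ))) d x = 0 := by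
  rw [ExteriorAlgebra.exteriorPower, pow_zero, Submodule.mem_one] at hx
  obtain ⟨r, rfl⟩ := hx
  exact contractLeft_algebraMap _ d r

theorem aux_contract_succ (m : ℕ) (d : Module.Dual ℝ (Fin m → ℝ)) (k : ℕ)
    (x : ExteriorAlgebra ℝ (Fin m → ℝ)) (hx : x ∈ ⋀[ℝ]^(k + 1) (Fin m → ℝ)) :
    contractLeft (Q := (0 : QuadraticForm ℝ (Fin m → ℝ))) d x ∈ ⋀[ℝ]^k (Fin m → ℝ) := by
  induction k generalizing x with
  | zero =>
    rw [zero_add, ExteriorAlgebra.exteriorPower, pow_one] at hx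
    obtain ⟨a, rfl⟩ := hx
    rw [ExteriorAlgebra.exteriorPower, pow_zero]
    have := contractLeft_ι (0 : QuadraticForm ℝ (Fin m → ℝ)) d a
    rw [Submodule.mem_one]
    exact ⟨d a, this.symm⟩
  | succ k ih =>
    rw [ExteriorAlgebra.exteriorPower, pow_succ'] at hx
    induction hx using Submodule.mul_induction_on' with
    | mem_mul_mem a ha b hb =>
      obtain ⟨a, rfl⟩ := ha
      have := contractLeft_ι_mul (Q := (0 : QuadraticForm ℝ (Fin m → ℝ))) d a b
      refine (congrArg (· ∈ _) this).mpr ?_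
      refine Submodule.sub_mem _ (Submodule.smul_mem _ _ hb) ?_
      have h := ih b hb
      rw [ExteriorAlgebra.exteriorPower, pow_succ']
      exact Submodule.mul_mem_mul ⟨a, rfl⟩ h
    | add x _ y _ hx hy =>
      rw [map_add]
      exact Submodule.add_mem _ hx hy

theorem aux_sum_proj (m : ℕ) (x : ExteriorAlgebra ℝ (Fin m → ℝ)) :
    ∑ l ∈ Finset.range (m + 1),
      GradedAlgebra.proj (fun i : ℕ => ⋀[ℝ]^i (Fin m → ℝ)) l x = x := by
  classical
  conv_rhs => rw [← DirectSum.sum_support_decompose (fun i : ℕ => ⋀[ℝ]^i (Fin m → ℝ)) x]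
  symm
  refine Finset.sum_subset_zero_on_sdiff ?_ ?_ ?_
  · intro l hl
    by_contra hlt
    rw [Finset.mem_range, not_lt] at hlt
    have hfr : Module.finrank ℝ (⋀[ℝ]^l (Fin m → ℝ)) = 0 := by
      rw [exteriorPower.finrank_eq, Module.finrank_fin_fun]
      exact Nat.choose_eq_zero_of_lt hlt
    have : Subsingleton (⋀[ℝ]^l (Fin m → ℝ)) := Module.finrank_zero_iff.mp hfr
    rw [DFinsupp.mem_support_iff] at hl
    exact hl (Subsingleton.elim _ _)
  · intro l hl
    rw [Finset.mem_sdiff, DFinsupp.mem_support_iff, not_not] at hl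
    rw [GradedAlgebra.proj_apply, hl.2]
    rfl
  · intro l _
    rfl

theorem aux_toExt_mul (n r : ℕ) (v : Fin (n + r) → ℝ) (x : GA n r) :
    gaToExt n r (ι (gaForm n r) v * x) = ExteriorAlgebra.ι ℝ v * gaToExt n r x +
      contractLeft (Q := (0 : QuadraticForm ℝ (Fin (n + r) → ℝ)))
        (QuadraticMap.associated (R := ℝ) (gaForm n r) v) (gaToExt n r x) := by
  have h := changeForm_ι_mul (changeForm.associated_neg_proof (Q := gaForm n r)) v x
  refine h.trans ?_
  have hB : QuadraticMap.associated (R := ℝ) (-gaForm n r) v =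
      -QuadraticMap.associated (R := ℝ) (gaForm n r) v := by
    rw [map_neg, LinearMap.neg_apply]
  rw [hB, (contractLeft (Q := (0 : QuadraticForm ℝ (Fin (n + r) → ℝ)))).map_neg,
    LinearMap.neg_apply, sub_neg_eq_add]
  rfl

theorem aux_toExt_contract (n r : ℕ) (d : Module.Dual ℝ (Fin (n + r) → ℝ)) (x : GA n r) :
    gaToExt n r (contractLeft d x) =
      contractLeft (Q := (0 : QuadraticForm ℝ (Fin (n + r) → ℝ))) d (gaToExt n r x) :=
  changeForm_contractLeft (changeForm.associated_neg_proof (Q := gaForm n r)) d x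

theorem aux_vContr (n r : ℕ) (v : Fin (n + r) → ℝ) (x : GA n r) :
    vContr n r v x =
      contractLeft (QuadraticMap.associated (R := ℝ) (gaForm n r) v) x := by
  apply (gaToExt n r).injective
  rw [aux_toExt_contract, vContr, map_sum]
  conv_rhs => rw [← aux_sum_proj (n + r) (gaToExt n r x), map_sum]
  refine Finset.sum_congr rfl fun l _ => ?_
  simp only [gradeProj, LinearMap.comp_apply, LinearEquiv.coe_coe, LinearEquiv.apply_symm_apply,
    aux_toExt_mul, map_add]
  have hy : GradedAlgebra.proj (fun i : ℕ => ⋀[ℝ]^i (Fin (n + r) → ℝ)) l (gaToExt n r x) ∈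
      ⋀[ℝ]^l (Fin (n + r) → ℝ) := by
    rw [GradedAlgebra.proj_apply]
    exact Subtype.prop _
  set y := GradedAlgebra.proj (fun i : ℕ => ⋀[ℝ]^i (Fin (n + r) → ℝ)) l (gaToExt n r x)
  have h1 : ExteriorAlgebra.ι ℝ v * y ∈ ⋀[ℝ]^(l + 1) (Fin (n + r) → ℝ) := by
    rw [ExteriorAlgebra.exteriorPower, pow_succ']
    exact Submodule.mul_mem_mul ⟨v, rfl⟩ hy
  rw [GradedAlgebra.proj_apply, DirectSum.decompose_of_mem_ne
    (fun i : ℕ => ⋀[ℝ]^i (Fin (n + r) → ℝ)) h1 (by omega), zero_add]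
  rcases l with _ | k
  · rw [aux_contract_zero _ _ _ hy, map_zero]
  · rw [GradedAlgebra.proj_apply]
    exact DirectSum.decompose_of_mem_same (fun i : ℕ => ⋀[ℝ]^i (Fin (n + r) → ℝ))
      (aux_contract_succ _ _ k _ hy)

theorem aux_comm (n r : ℕ) (v : Fin (n + r) → ℝ) (x : GA n r) :
    ι (gaForm n r) v * x - involute x * ι (gaForm n r) v =
      (2 : ℝ) • contractLeft (QuadraticMap.associated (R := ℝ) (gaForm n r) v) x := by
  induction x using CliffordAlgebra.left_induction with
  | algebraMap s =>
    rw [contractLeft_algebraMap, smul_zero, AlgHom.commutes, Algebra.commutes, sub_self]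
  | add x y hx hy =>
    rw [map_add, map_add, smul_add, ← hx, ← hy]
    noncomm_ring
  | ι_mul x m hx =>
    have h := ι_mul_ι_add_swap (Q := gaForm n r) v m
    have hp : QuadraticMap.polar (gaForm n r) v m =
        2 * QuadraticMap.associated (R := ℝ) (gaForm n r) v m := by
      have h2 := LinearMap.congr_fun₂ (QuadraticMap.two_nsmul_associated ℝ (gaForm n r)) v m
      rw [← QuadraticMap.polarBilin_apply_apply, ← h2, LinearMap.smul_apply, LinearMap.smul_apply,
        two_nsmul, two_mul]
    rw [hp] at h
    rw [contractLeft_ι_mul, smul_sub, ← mul_smul_comm, ← hx, map_mul, involute_ι, smul_smul,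
      Algebra.smul_def, ← h]
    noncomm_ring

theorem aux_e0_polar (n : ℕ) (w : Fin (n + 1) → ℝ) :
    QuadraticMap.polar (gaForm n 1) (gaBasisVec n 1 (Fin.last n)) w = 0 := by
  simp only [QuadraticMap.polar, gaForm, QuadraticMap.weightedSumSquares_apply,
    gaBasisVec, ← Finset.sum_sub_distrib]
  refine Finset.sum_eq_zero fun i _ => ?_
  by_cases hi : (i : ℕ) < n
  · have : i ≠ Fin.last n := by
      rintro rfl
      simp at hi
    simp [this]
  · simp [hi]

theorem aux_e0_form (n : ℕ) : gaForm n 1 (gaBasisVec n 1 (Fin.last n)) = 0 := by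
  have h := aux_e0_polar n (gaBasisVec n 1 (Fin.last n))
  rw [QuadraticMap.polar_self] at h
  simpa using h

theorem aux_e0_sq (n : ℕ) : e0 n * e0 n = 0 := by
  rw [e0, eVec, ι_sq_scalar, aux_e0_form, map_zero]

theorem aux_e0_swap (n : ℕ) (w : Fin (n + 1) → ℝ) :
    ι (gaForm n 1) w * e0 n = - (e0 n * ι (gaForm n 1) w) := by
  have h := ι_mul_ι_add_swap (Q := gaForm n 1) (gaBasisVec n 1 (Fin.last n)) w
  rw [aux_e0_polar, map_zero] at h
  exact eq_neg_of_add_eq_zero_right h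

theorem aux_e0_comm (n : ℕ) (x : GA n 1) : x * e0 n = e0 n * involute x := by
  induction x using CliffordAlgebra.left_induction with
  | algebraMap s => rw [AlgHom.commutes, Algebra.commutes]
  | add x y hx hy => rw [map_add, add_mul, mul_add, hx, hy]
  | ι_mul x m hx =>
    rw [mul_assoc, hx, ← mul_assoc, aux_e0_swap, map_mul, involute_ι]
    noncomm_ring

theorem aux_e0_mid (n : ℕ) (x : GA n 1) : e0 n * x * e0 n = 0 := by
  rw [mul_assoc, aux_e0_comm, ← mul_assoc, aux_e0_sq, zero_mul]

theorem aux_form_nonneg (n : ℕ) (v : Fin (n + 1) → ℝ) : 0 ≤ gaForm n 1 v := by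
  simp only [gaForm, QuadraticMap.weightedSumSquares_apply]
  refine Finset.sum_nonneg fun i _ => ?_
  split_ifs
  · simpa using mul_self_nonneg (v i)
  · simp

theorem aux_form_zero (n : ℕ) (v : Fin (n + 1) → ℝ) (hv : IsEuclideanVec n 1 v)
    (h : gaForm n 1 v = 0) : v = 0 := by
  funext i
  by_cases hi : n ≤ (i : ℕ)
  · exact hv i hi
  · simp only [gaForm, QuadraticMap.weightedSumSquares_apply] at h
    rw [Finset.sum_eq_zero_iff_of_nonneg] at h
    · have := h i (Finset.mem_univ i)
      rw [not_le] at hi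
      simpa [hi] using this
    · intro j _
      split_ifs
      · simpa using mul_self_nonneg (v j)
      · simp

/-- In `G_{n,0,1}`, for every Euclidean vector `v`, the element
`τ = 1 − e₀ v / 2` lies in `Spin(n,0,1)` (it is a product of an even number of unit
vectors) and its sandwich action is `τ[x] = τ x τ⁻¹ = x − e₀ (v ⌋ x)`. -/
theorem translation_action (n : ℕ) (v : Fin (n + 1) → ℝ) (hv : IsEuclideanVec n 1 v) :
    (∃ l : List (Fin (n + 1) → ℝ), IsUnitVecList n 1 l ∧ Even l.length ∧
      versor n 1 l = 1 - (2⁻¹ : ℝ) • (e0 n * ι (gaForm n 1) v)) ∧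
    ∀ x : GA n 1,
      (1 - (2⁻¹ : ℝ) • (e0 n * ι (gaForm n 1) v)) * x *
          Ring.inverse (1 - (2⁻¹ : ℝ) • (e0 n * ι (gaForm n 1) v)) =
        x - e0 n * vContr n 1 v x := by
  constructor
  · by_cases hv0 : v = 0
    · refine ⟨[], by simp [IsUnitVecList], by simp, ?_⟩
      simp [versor, hv0]
    · have hpos : 0 < gaForm n 1 v :=
        lt_of_le_of_ne (aux_form_nonneg n v) fun h => hv0 (aux_form_zero n v hv h.symm)
      set c := Real.sqrt (gaForm n 1 v) with hc
      have hc0 : c ≠ 0 := (Real.sqrt_pos.mpr hpos).ne'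
      have hcc : c * c = gaForm n 1 v := Real.mul_self_sqrt hpos.le
      have hu : gaForm n 1 (c⁻¹ • v) = 1 := by
        rw [QuadraticMap.map_smul, ← hcc, smul_eq_mul]
        field_simp
      have hw : gaForm n 1 (c⁻¹ • v + (-(c / 2)) • gaBasisVec n 1 (Fin.last n)) = 1 := by
        rw [QuadraticMap.map_add (gaForm n 1), hu, QuadraticMap.map_smul, aux_e0_form,
          QuadraticMap.polar_smul_right, QuadraticMap.polar_comm, aux_e0_polar]
        simp
      refine ⟨[c⁻¹ • v + (-(c / 2)) • gaBasisVec n 1 (Fin.last n), c⁻¹ • v], ?_, by simp, ?_⟩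
      · intro w hw'
        simp only [List.mem_cons, List.not_mem_nil, or_false] at hw'
        rcases hw' with rfl | rfl
        · exact hw
        · exact hu
      · have hsq : ι (gaForm n 1) (c⁻¹ • v) * ι (gaForm n 1) (c⁻¹ • v) = 1 := by
          rw [ι_sq_scalar, hu, map_one]
        have he : ι (gaForm n 1) (gaBasisVec n 1 (Fin.last n)) = e0 n := rfl
        simp only [versor, List.map_cons, List.map_nil, List.prod_cons, List.prod_nil, mul_one]
        rw [map_add, add_mul, hsq, map_smul, map_smul, he, smul_mul_smul_comm, sub_eq_add_neg,
          ← neg_smul]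
        congr 2
        field_simp
  · intro x
    rw [aux_vContr]
    set a := (2⁻¹ : ℝ) • (e0 n * ι (gaForm n 1) v) with ha
    have hmid : ∀ y : GA n 1, a * y * a = 0 := by
      intro y
      have h := aux_e0_mid n (ι (gaForm n 1) v * y)
      have : e0 n * ι (gaForm n 1) v * y * (e0 n * ι (gaForm n 1) v) =
          (e0 n * (ι (gaForm n 1) v * y) * e0 n) * ι (gaForm n 1) v := by
        noncomm_ring
      rw [ha, smul_mul_assoc, smul_mul_smul_comm, this, h, zero_mul, smul_zero]
    have haa : a * a = 0 := by simpa using hmid 1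
    have h1 : (1 - a) * (1 + a) = 1 := by
      have : (1 - a) * (1 + a) = 1 - a * a := by noncomm_ring
      rw [this, haa, sub_zero]
    have h2 : (1 + a) * (1 - a) = 1 := by
      have : (1 + a) * (1 - a) = 1 - a * a := by noncomm_ring
      rw [this, haa, sub_zero]
    have hinv : Ring.inverse (1 - a) = 1 + a :=
      Ring.inverse_unit (⟨1 - a, 1 + a, h1, h2⟩ : (GA n 1)ˣ)
    rw [hinv]
    have h3 : (1 - a) * x * (1 + a) = x - (a * x - x * a) - a * x * a := by noncomm_ring
    rw [h3, hmid, sub_zero]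
    congr 1
    have hcom := aux_comm n 1 v x
    have h4 : a * x - x * a = (2⁻¹ : ℝ) •
        (e0 n * (ι (gaForm n 1) v * x - involute x * ι (gaForm n 1) v)) := by
      rw [ha, smul_mul_assoc, mul_smul_comm, ← smul_sub, ← mul_assoc x, aux_e0_comm, mul_sub,
        mul_assoc, mul_assoc]
    rw [h4, hcom, mul_smul_comm, smul_smul, inv_mul_cancel₀ two_ne_zero, one_smul]

end
end
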